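/- arXiv:2005.08299 — 2 statements merged into one kernel-verified Lean document; each statement's English description precedes it below -/
import Mathlib

section
/- If S is a selfadjoint invertible bounded operator on a complex Hilbert space H, then for every bounded operator X on H, ‖S X S⁻¹ + S⁻¹ X S‖ ≥ 2‖X‖. -/
theorem cpr_key (H : Type*) [NormedAddCommGroup H] [InnerProductSpace ℂ H]
    [CompleteSpace H] (S Sinv : H →L[ℂ] H) (hsa : IsSelfAdjoint S)
    (hS1 : S * Sinv = 1) (hS2 : Sinv * S = 1) (X : H →L[ℂ] H)
    (hd : 0 < 2 * ‖X‖ - ‖S * X * Sinv + Sinv * X * S‖) (x : H) :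
    ‖X x‖ ^ 2 * ((2 * ‖X‖ - ‖S * X * Sinv + Sinv * X * S‖) ^ 2 + (‖Sinv‖ * ‖S‖) ^ 2 * ‖X‖ ^ 2)
      ≤ (‖Sinv‖ * ‖S‖) ^ 2 * ‖X‖ ^ 4 * ‖x‖ ^ 2 := by
  have h1 : ∀ y, S (Sinv y) = y := fun y => congrArg (fun T : H →L[ℂ] H => T y) hS1
  have h2 : ∀ y, Sinv (S y) = y := fun y => congrArg (fun T : H →L[ℂ] H => T y) hS2
  have hs : ∀ y z, inner ℂ (S y) z = inner ℂ y (S z) := fun y z =>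
    (ContinuousLinearMap.isSelfAdjoint_iff_isSymmetric.mp hsa) y z
  have hi : ∀ y z, inner ℂ (Sinv y) (S z) = inner ℂ y z := fun y z => by
    rw [← hs, h1]
  set A := S * X * Sinv + Sinv * X * S with hA
  set m := ‖X‖ with hm
  set e := (ContinuousLinearMap.adjoint X) (X x) - ((m ^ 2 : ℝ) : ℂ) • x with he
  have hm0 : 0 ≤ m := norm_nonneg _
  have hAu : A (S x) = S (X x) + Sinv (X (S (S x))) := by simp [hA, h2]
  have hin : inner ℂ (A (S x)) (S (X x)) = ((‖S (X x)‖ ^ 2 + m ^ 2 * ‖S x‖ ^ 2 : ℝ) : ℂ)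
      + inner ℂ (S (S x)) e := by
    rw [hAu, inner_add_left, hi, he, inner_sub_right, inner_smul_right,
      ContinuousLinearMap.adjoint_inner_right, hs (S x) x, inner_self_eq_norm_sq_to_K,
      inner_self_eq_norm_sq_to_K]
    push_cast
    simp
  have hb1 : ‖S (X x)‖ ^ 2 + m ^ 2 * ‖S x‖ ^ 2 ≤ ‖A‖ * ‖S x‖ * ‖S (X x)‖ + ‖S‖ * ‖S x‖ * ‖e‖ := by
    have e1 : ((‖S (X x)‖ ^ 2 + m ^ 2 * ‖S x‖ ^ 2 : ℝ) : ℂ) =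
      inner ℂ (A (S x)) (S (X x)) - inner ℂ (S (S x)) e := by rw [hin]; ring
    have e2 := congrArg norm e1
    rw [Complex.norm_of_nonneg (by positivity)] at e2
    rw [e2]
    refine (norm_sub_le _ _).trans (add_le_add ?_ ?_)
    · refine (norm_inner_le_norm _ _).trans ?_
      gcongr
      exact A.le_opNorm _
    · refine (norm_inner_le_norm _ _).trans ?_
      gcongr
      exact S.le_opNorm _
  have hee : ‖e‖ ^ 2 ≤ m ^ 2 * (m ^ 2 * ‖x‖ ^ 2 - ‖X x‖ ^ 2) := by
    rw [he, @norm_sub_sq ℂ, inner_smul_right, ContinuousLinearMap.adjoint_inner_left,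
      inner_self_eq_norm_sq_to_K, norm_smul]
    have : ‖(ContinuousLinearMap.adjoint X) (X x)‖ ≤ m * ‖X x‖ := by
      refine (ContinuousLinearMap.le_opNorm _ _).trans ?_
      rw [LinearIsometryEquiv.norm_map]
    have h3 := pow_le_pow_left₀ (norm_nonneg _) this 2
    have h4 : RCLike.re (((m ^ 2 : ℝ) : ℂ) * ((‖X x‖ : ℝ) : ℂ) ^ 2) = m ^ 2 * ‖X x‖ ^ 2 := by
      norm_cast
    have h5 : ‖((m ^ 2 : ℝ) : ℂ)‖ = m ^ 2 := Complex.norm_of_nonneg (by positivity)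
    erw [h4]
    rw [h5]
    nlinarith
  by_cases hx : S x = 0
  · have : x = 0 := by rw [← h2 x, hx, map_zero]
    simp [this]
  have hu : 0 < ‖S x‖ := norm_pos_iff.mpr hx
  have hv : (2 * m - ‖A‖) * ‖S (X x)‖ ≤ ‖S‖ * ‖e‖ := by
    refine le_of_mul_le_mul_left ?_ hu
    nlinarith [sq_nonneg (‖S (X x)‖ - m * ‖S x‖)]
  have hw : ‖X x‖ ≤ ‖Sinv‖ * ‖S (X x)‖ := by
    simpa [h2] using Sinv.le_opNorm (S (X x))
  have hf : (2 * m - ‖A‖) * ‖X x‖ ≤ ‖Sinv‖ * ‖S‖ * ‖e‖ := by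
    calc _ ≤ (2 * m - ‖A‖) * (‖Sinv‖ * ‖S (X x)‖) := by gcongr
      _ = ‖Sinv‖ * ((2 * m - ‖A‖) * ‖S (X x)‖) := by ring
      _ ≤ ‖Sinv‖ * (‖S‖ * ‖e‖) := by gcongr
      _ = _ := by ring
  have hg := pow_le_pow_left₀ (by positivity) hf 2
  have hh := mul_le_mul_of_nonneg_left hee (sq_nonneg (‖Sinv‖ * ‖S‖))
  nlinarith

theorem corach_porta_recht (H : Type*) [NormedAddCommGroup H] [InnerProductSpace ℂ H]
    [CompleteSpace H] (S Sinv : H →L[ℂ] H) (hsa : IsSelfAdjoint S)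
    (hS1 : S * Sinv = 1) (hS2 : Sinv * S = 1) (X : H →L[ℂ] H) :
    ‖S * X * Sinv + Sinv * X * S‖ ≥ 2 * ‖X‖ := by
  by_contra hcon
  have hd : 0 < 2 * ‖X‖ - ‖S * X * Sinv + Sinv * X * S‖ := by linarith [not_le.mp hcon]
  have key := cpr_key H S Sinv hsa hS1 hS2 X hd
  have hm : 0 < ‖X‖ := by linarith [norm_nonneg (S * X * Sinv + Sinv * X * S)]
  generalize 2 * ‖X‖ - ‖S * X * Sinv + Sinv * X * S‖ = d at hd key
  generalize ‖Sinv‖ * ‖S‖ = K at key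
  have hD : 0 < d ^ 2 + K ^ 2 * ‖X‖ ^ 2 := by positivity
  have hle : ‖X‖ ≤ √(K ^ 2 * ‖X‖ ^ 4 / (d ^ 2 + K ^ 2 * ‖X‖ ^ 2)) := by
    refine X.opNorm_le_bound (Real.sqrt_nonneg _) fun x => ?_
    refine (sq_le_sq₀ (norm_nonneg _) (by positivity)).mp ?_
    rw [mul_pow, Real.sq_sqrt (by positivity), div_mul_eq_mul_div, le_div_iff₀ hD]
    exact key x
  have h := pow_le_pow_left₀ hm.le hle 2
  rw [Real.sq_sqrt (by positivity), le_div_iff₀ hD] at h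
  have : 0 < ‖X‖ ^ 2 * d ^ 2 := by positivity
  nlinarith
end

section
/- Let S be an invertible bounded operator on a complex Hilbert space H such that for all x, y ∈ H, (‖Sx‖ − ‖S*x‖)·‖(S*)⁻¹y‖ ≤ (‖Sy‖ − ‖S*y‖)·‖S⁻¹x‖, and suppose ‖Sx‖ ≥ ‖S*x‖ for all x ∈ H. Then S is normal. -/
theorem normal_of_norm_ineq (H : Type*) [NormedAddCommGroup H]
    [InnerProductSpace ℂ H] [CompleteSpace H] (S Sinv : H →L[ℂ] H)
    (hS1 : S * Sinv = 1) (hS2 : Sinv * S = 1)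
    (hineq : ∀ x y : H,
      (‖S x‖ - ‖(star S) x‖) * ‖(star Sinv) y‖ ≤ (‖S y‖ - ‖(star S) y‖) * ‖Sinv x‖)
    (hdom : ∀ x : H, ‖S x‖ ≥ ‖(star S) x‖) :
    (star S) * S = S * (star S) := by
  have key : ∀ x, ‖S x‖ = ‖(star S) x‖ := by
    intro x
    by_contra hne
    have hd : 0 < ‖S x‖ - ‖(star S) x‖ :=
      sub_pos.2 (lt_of_le_of_ne (hdom x) (Ne.symm hne))
    set d := ‖S x‖ - ‖(star S) x‖ with hdd
    have hx : 0 < ‖x‖ := by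
      rw [norm_pos_iff]
      rintro rfl
      simp at hne
    have hstar : star S * star Sinv = 1 := by rw [← star_mul, hS2, star_one]
    have hn : ‖star S‖ = ‖S‖ := norm_star S
    have hb : ∀ y, ‖y‖ ≤ ‖S‖ * ‖(star Sinv) y‖ := by
      intro y
      have h1 : (star S) ((star Sinv) y) = y := by
        have := congrArg (fun T : H →L[ℂ] H => T y) hstar
        simpa using this
      have h2 := (star S).le_opNorm ((star Sinv) y)
      rwa [h1, hn] at h2
    set K := ‖S‖ * ‖Sinv x‖ with hK
    have hmain : ∀ y, d * ‖y‖ ≤ K * (‖S‖ * ‖y‖ - ‖(star S) y‖) := by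
      intro y
      calc d * ‖y‖ ≤ d * (‖S‖ * ‖(star Sinv) y‖) := by gcongr; exact hb y
        _ = ‖S‖ * (d * ‖(star Sinv) y‖) := by ring
        _ ≤ ‖S‖ * ((‖S y‖ - ‖(star S) y‖) * ‖Sinv x‖) := by
            gcongr ‖S‖ * ?_
            exact hineq x y
        _ = K * (‖S y‖ - ‖(star S) y‖) := by rw [hK]; ring
        _ ≤ K * (‖S‖ * ‖y‖ - ‖(star S) y‖) := by
            gcongr
            exact S.le_opNorm y
    have hK0 : 0 < K := by
      have h0 : 0 ≤ K := by positivity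
      rcases h0.lt_or_eq with h | h
      · exact h
      · have := hmain x
        rw [← h, zero_mul] at this
        nlinarith [mul_pos hd hx]
    have hbd : ∀ y, ‖(star S) y‖ ≤ (‖S‖ - d / K) * ‖y‖ := by
      intro y
      have h := hmain y
      have h2 : d / K * ‖y‖ ≤ ‖S‖ * ‖y‖ - ‖(star S) y‖ := by
        rw [div_mul_eq_mul_div, div_le_iff₀ hK0]
        linarith
      linarith
    have hnn : 0 ≤ ‖S‖ - d / K :=
      nonneg_of_mul_nonneg_left ((norm_nonneg _).trans (hbd x)) hx
    have hle := (star S).opNorm_le_bound hnn hbd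
    rw [hn] at hle
    have : 0 < d / K := by positivity
    linarith
  have hN : IsStarNormal S :=
    ContinuousLinearMap.isStarNormal_iff_norm_eq_adjoint.2 key
  exact hN.star_comm_self
end
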